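/- The number of edge-magic total labelings of the path P_5 (the path with 6 vertices and 5 edges), counted up to the reversal symmetry of the path, is 240. -/

import Mathlib

/-- The path `P n` has vertices `0,…,n` and edges `{j,j+1}` for `0 ≤ j < n`, a total of
`2n+1` graph elements, encoded as `Fin (2n+1)` with vertex `j` at index `2j` and edge
`{j,j+1}` at index `2j+1`.  An edge-magic total labeling is a bijection from these
elements to `{1,…,2n+1}` (encoded as a permutation `σ` of `Fin (2n+1)`, the label of
element `x` being `(σ x).val + 1`) such that every edge weight
`λ(u) + λ({u,v}) + λ(v)` equals a common constant `k`.  This counts such labelings up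
to the reversal symmetry of the path, i.e. those with `λ(vertex 0) < λ(vertex n)`. -/
noncomputable def pathEMTLCountUpToRev (n : ℕ) : ℕ := by
  classical
  exact (Finset.univ.filter (fun σ : Equiv.Perm (Fin (2 * n + 1)) =>
    (∃ k : ℕ, ∀ i : Fin n,
      ((σ ⟨2 * i.1, by have := i.isLt; omega⟩).val + 1) +
      ((σ ⟨2 * i.1 + 1, by have := i.isLt; omega⟩).val + 1) +
      ((σ ⟨2 * i.1 + 2, by have := i.isLt; omega⟩).val + 1) = k) ∧
    (σ ⟨0, by omega⟩).val < (σ ⟨2 * n, by omega⟩).val)).card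

/-- Evaluate `x` to a numeral before passing it on (this only matters for reduction speed). -/
def emtlForce {α : Type} (x : ℕ) (f : ℕ → α) : α :=
  Nat.rec (f 0) (fun n _ => f (Nat.succ n)) x

/-- The number `x` does not occur in the list. -/
def emtlFresh (x : ℕ) (l : List ℕ) : Bool :=
  List.rec true (fun y _ ih => Bool.rec ih false (Nat.beq x y)) l

/-- Try `e` as next edge label. -/
def emtlTry (s a : ℕ) (l : List ℕ) (e : ℕ) (r : List (List ℕ)) : List (List ℕ) :=
  Bool.rec r (Bool.rec r (Bool.rec r (emtlForce (Nat.sub s (Nat.add a e)) fun v =>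
    Bool.rec r (((v :: e :: l) :: r)) (emtlFresh v (e :: l)))
    (Nat.ble s (Nat.add (Nat.add a e) 10))) (emtlFresh e l)) (Nat.ble (Nat.add a e) s)

/-- Extend a reversed partial labeling by one edge and one vertex, with edge sum `s`. -/
def emtlStep (s : ℕ) (l : List ℕ) : List (List ℕ) :=
  [0, 1, 2, 3, 4, 5, 6, 7, 8, 9, 10].foldr (emtlTry s (l.headD 0) l) []

theorem emtlForce_eq {α : Type} (x : ℕ) (f : ℕ → α) : emtlForce x f = f x := by
  cases x <;> rfl

theorem emtlFresh_eq {x : ℕ} {l : List ℕ} (h : x ∉ l) : emtlFresh x l = true := by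
  induction l with
  | nil => rfl
  | cons y l ih =>
    have h1 : Nat.beq x y = false := by
      cases hb : Nat.beq x y with
      | false => rfl
      | true => exact absurd (Nat.eq_of_beq_eq_true hb) (List.ne_of_not_mem_cons h)
    have h2 := ih (List.not_mem_of_not_mem_cons h)
    change Bool.rec (emtlFresh x l) false (Nat.beq x y) = true
    rw [h1]
    exact h2

theorem emtlTry_mono {s a e : ℕ} {l x : List ℕ} {r : List (List ℕ)} (h : x ∈ r) :
    x ∈ emtlTry s a l e r := by
  unfold emtlTry
  rw [emtlForce_eq]
  cases Nat.ble (Nat.add a e) s <;> [exact h; skip]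
  cases emtlFresh e l <;> [exact h; skip]
  cases Nat.ble s (Nat.add (Nat.add a e) 10) <;> [exact h; skip]
  cases emtlFresh (Nat.sub s (Nat.add a e)) (e :: l) <;>
    [exact h; exact List.mem_cons_of_mem _ h]

theorem emtlTry_self {s a e v : ℕ} {l : List ℕ} {r : List (List ℕ)} (hv : v < 11)
    (hs : a + e + v = s) (hn : (v :: e :: l).Nodup) : (v :: e :: l) ∈ emtlTry s a l e r := by
  have hv' : Nat.sub s (Nat.add a e) = v := by
    change s - (a + e) = v
    omega
  have b1 : Nat.ble (Nat.add a e) s = true := Nat.ble_eq_true_of_le (by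
    change a + e ≤ s
    omega)
  have b2 : Nat.ble s (Nat.add (Nat.add a e) 10) = true := Nat.ble_eq_true_of_le (by
    change s ≤ a + e + 10
    omega)
  have b3 := emtlFresh_eq (List.nodup_cons.1 (List.nodup_cons.1 hn).2).1
  have b4 := emtlFresh_eq (List.nodup_cons.1 hn).1
  unfold emtlTry
  rw [emtlForce_eq, hv', b1, b2, b3, b4]
  exact List.mem_cons_self

theorem mem_foldr_emtlTry {s a e v : ℕ} {l : List ℕ} (L : List ℕ) (he : e ∈ L) (hv : v < 11)
    (hs : a + e + v = s) (hn : (v :: e :: l).Nodup) :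
    (v :: e :: l) ∈ L.foldr (emtlTry s a l) [] := by
  induction L with
  | nil => simp at he
  | cons y L ih =>
    rw [List.foldr_cons]
    rcases List.mem_cons.1 he with rfl | h
    · exact emtlTry_self hv hs hn
    · exact emtlTry_mono (ih h)

theorem mem_emtlLabels {e : ℕ} (he : e < 11) : e ∈ [0, 1, 2, 3, 4, 5, 6, 7, 8, 9, 10] := by
  interval_cases e <;> simp

theorem mem_emtlStep {s a e v : ℕ} {l : List ℕ} (he : e < 11) (hv : v < 11)
    (hs : a + e + v = s) (hn : (v :: e :: a :: l).Nodup) :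
    (v :: e :: a :: l) ∈ emtlStep s (a :: l) :=
  mem_foldr_emtlTry _ (mem_emtlLabels he) hv hs hn

/-- All labelings of `P 5`, found by backtracking. -/
def emtlGen : List (List ℕ) :=
  [0, 1, 2, 3, 4, 5, 6, 7, 8, 9, 10].flatMap fun a => [13, 14, 15, 16, 17].flatMap fun s =>
    (((((emtlStep s [a]).flatMap (emtlStep s)).flatMap (emtlStep s)).flatMap
      (emtlStep s)).flatMap (emtlStep s)).filter (fun l => Nat.blt a (l.headD 0))

/-- Read a list as a self-map of `Fin 11`, from its end. -/
def emtlFun (l : List ℕ) (i : Fin 11) : Fin 11 := Fin.ofNat 11 (l.getD (10 - i.1) 0)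

/-- The reversed list of values of a self-map of `Fin 11`. -/
def emtlList (f : Fin 11 → Fin 11) : List ℕ :=
  [(f 10).val, (f 9).val, (f 8).val, (f 7).val, (f 6).val, (f 5).val, (f 4).val, (f 3).val,
    (f 2).val, (f 1).val, (f 0).val]

/-- The magic condition together with the order condition. -/
def emtlCond (f : Fin 11 → Fin 11) : Prop :=
  (f 2).val + (f 3).val + (f 4).val = (f 0).val + (f 1).val + (f 2).val ∧
  (f 4).val + (f 5).val + (f 6).val = (f 0).val + (f 1).val + (f 2).val ∧
  (f 6).val + (f 7).val + (f 8).val = (f 0).val + (f 1).val + (f 2).val ∧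
  (f 8).val + (f 9).val + (f 10).val = (f 0).val + (f 1).val + (f 2).val ∧
  (f 0).val < (f 10).val

instance (f : Fin 11 → Fin 11) : Decidable (emtlCond f) := by
  unfold emtlCond; infer_instance


theorem emtlGen_all : emtlGen.length = 240 ∧ emtlGen.Nodup ∧
  ∀ l ∈ emtlGen, (emtlList (emtlFun l)).Nodup ∧
    emtlList (emtlFun l) = l ∧ emtlCond (emtlFun l) := by decide +kernel

theorem emtlList_nodup (f : Fin 11 → Fin 11) : (emtlList f).Nodup ↔ Function.Injective f := by
  have h : emtlList f = (List.ofFn (fun i => (f i).val)).reverse := by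
    simp [emtlList, List.ofFn_succ]
  rw [h, List.nodup_reverse, List.nodup_ofFn]
  exact ⟨fun h a b hab => h (congrArg Fin.val hab), fun h a b hab => h (Fin.ext hab)⟩

theorem emtl_mem (f : Fin 11 → Fin 11) (hf : Function.Injective f) (hc : emtlCond f) :
    emtlList f ∈ emtlGen := by
  have n0 := (emtlList_nodup f).2 hf
  obtain ⟨c1, c2, c3, c4, c5⟩ := hc
  unfold emtlList at n0 ⊢
  have n1 := (List.nodup_cons.1 (List.nodup_cons.1 n0).2).2
  have n2 := (List.nodup_cons.1 (List.nodup_cons.1 n1).2).2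
  have n3 := (List.nodup_cons.1 (List.nodup_cons.1 n2).2).2
  have n4 := (List.nodup_cons.1 (List.nodup_cons.1 n3).2).2
  have hsum : ∑ i, (f i).val = 55 := by
    have := Equiv.sum_comp (Equiv.ofBijective f (Finite.injective_iff_bijective.1 hf))
      (fun i : Fin 11 => i.val)
    rw [show (∑ i : Fin 11, i.val) = 55 from by decide] at this
    exact this
  have hsum' : (f 0).val + (f 1).val + (f 2).val + (f 3).val + (f 4).val + (f 5).val
      + (f 6).val + (f 7).val + (f 8).val + (f 9).val + (f 10).val = 55 := by
    rw [← hsum]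
    simp [Fin.sum_univ_succ, add_assoc]
  have hne : ∀ i j : Fin 11, i ≠ j → (f i).val ≠ (f j).val :=
    fun i j hij h => hij (hf (Fin.ext h))
  have d1 := hne 2 4 (by decide)
  have d2 := hne 2 6 (by decide)
  have d3 := hne 2 8 (by decide)
  have d4 := hne 4 6 (by decide)
  have d5 := hne 4 8 (by decide)
  have d6 := hne 6 8 (by decide)
  have hlo : 6 ≤ (f 2).val + (f 4).val + (f 6).val + (f 8).val := by
    clear hsum hsum' c1 c2 c3 c4 c5
    omega
  have hhi : (f 2).val + (f 4).val + (f 6).val + (f 8).val ≤ 34 := by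
    clear hsum hsum' c1 c2 c3 c4 c5 hlo
    omega
  have hs : (f 0).val + (f 1).val + (f 2).val ∈ [13, 14, 15, 16, 17] := by
    clear d1 d2 d3 d4 d5 d6
    have h1 : 13 ≤ (f 0).val + (f 1).val + (f 2).val := by omega
    have h2 : (f 0).val + (f 1).val + (f 2).val ≤ 17 := by omega
    simp only [List.mem_cons, List.not_mem_nil, or_false]
    omega
  simp only [emtlGen, List.mem_flatMap, List.mem_filter]
  refine ⟨(f 0).val, mem_emtlLabels (f 0).isLt, (f 0).val + (f 1).val + (f 2).val, hs,
    ⟨_, ⟨_, ⟨_, ⟨_, mem_emtlStep (f 1).isLt (f 2).isLt rfl n4,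
      mem_emtlStep (f 3).isLt (f 4).isLt c1 n3⟩,
      mem_emtlStep (f 5).isLt (f 6).isLt c2 n2⟩,
      mem_emtlStep (f 7).isLt (f 8).isLt c3 n1⟩,
      mem_emtlStep (f 9).isLt (f 10).isLt c4 n0⟩, Nat.ble_eq_true_of_le c5⟩

theorem emtlList_inj {f g : Fin 11 → Fin 11} (h : emtlList f = emtlList g) : f = g := by
  simp only [emtlList, List.cons.injEq, and_true, Fin.val_inj] at h
  funext i
  fin_cases i <;> simp [h]

theorem emtlCond_iff (f : Fin 11 → Fin 11) :
    ((∃ k : ℕ, ∀ i : Fin 5,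
      ((f ⟨2 * i.1, by have := i.isLt; omega⟩).val + 1) +
      ((f ⟨2 * i.1 + 1, by have := i.isLt; omega⟩).val + 1) +
      ((f ⟨2 * i.1 + 2, by have := i.isLt; omega⟩).val + 1) = k) ∧
    (f ⟨0, by omega⟩).val < (f ⟨2 * 5, by omega⟩).val) ↔ emtlCond f := by
  constructor
  · rintro ⟨⟨k, hk⟩, h⟩
    have h0 : (f 0).val + 1 + ((f 1).val + 1) + ((f 2).val + 1) = k := hk 0
    have h1 : (f 2).val + 1 + ((f 3).val + 1) + ((f 4).val + 1) = k := hk 1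
    have h2 : (f 4).val + 1 + ((f 5).val + 1) + ((f 6).val + 1) = k := hk 2
    have h3 : (f 6).val + 1 + ((f 7).val + 1) + ((f 8).val + 1) = k := hk 3
    have h4 : (f 8).val + 1 + ((f 9).val + 1) + ((f 10).val + 1) = k := hk 4
    exact ⟨by omega, by omega, by omega, by omega, h⟩
  · rintro ⟨c1, c2, c3, c4, c5⟩
    refine ⟨⟨(f 0).val + 1 + ((f 1).val + 1) + ((f 2).val + 1), fun i => ?_⟩, c5⟩
    match i with
    | 0 => rfl
    | 1 =>
      change (f 2).val + 1 + ((f 3).val + 1) + ((f 4).val + 1) = _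
      omega
    | 2 =>
      change (f 4).val + 1 + ((f 5).val + 1) + ((f 6).val + 1) = _
      omega
    | 3 =>
      change (f 6).val + 1 + ((f 7).val + 1) + ((f 8).val + 1) = _
      omega
    | 4 =>
      change (f 8).val + 1 + ((f 9).val + 1) + ((f 10).val + 1) = _
      omega

/-- The number of edge-magic total labelings of the path `P 5`, counted up to the
reversal symmetry of the path, is `240`. -/
theorem pathEMTLCountUpToRev_P5 : pathEMTLCountUpToRev 5 = 240 := by
  classical
  rw [← emtlGen_all.1, ← List.toFinset_card_of_nodup emtlGen_all.2.1]
  unfold pathEMTLCountUpToRev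
  refine Finset.card_bij (fun σ _ => emtlList (σ : Fin 11 → Fin 11)) ?_ ?_ ?_
  · intro σ hσ
    rw [Finset.mem_filter] at hσ
    rw [List.mem_toFinset]
    exact emtl_mem _ σ.injective ((emtlCond_iff _).1 hσ.2)
  · intro σ _ τ _ h
    exact DFunLike.coe_injective (emtlList_inj h)
  · intro l hl
    obtain ⟨h1, h2, h3⟩ := emtlGen_all.2.2 l (List.mem_toFinset.1 hl)
    have hb : Function.Bijective (emtlFun l) :=
      Finite.injective_iff_bijective.1 ((emtlList_nodup _).1 h1)
    refine ⟨Equiv.ofBijective (emtlFun l) hb, ?_, h2⟩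
    rw [Finset.mem_filter]
    exact ⟨Finset.mem_univ _, (emtlCond_iff (emtlFun l)).2 h3⟩
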